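/- Let K be an algebraically closed field of characteristic zero. Then any two finite subgroups of PGL(2,K) that are isomorphic as abstract groups are conjugate in PGL(2,K). -/

import Mathlib

open Matrix

/-- The projective general linear group `PGL(2,K)`: the quotient of `GL(2,K)` by its
center, the subgroup of nonzero scalar matrices. -/
abbrev PGL2 (K : Type*) [Field K] : Type _ :=
  GL (Fin 2) K ⧸ Subgroup.center (GL (Fin 2) K)

theorem arith_three (N e0 e1 e2 m0 m1 m2 : ℕ) 
    (h0 : e0 * m0 = N) (h1 : e1 * m1 = N) (h2 : e2 * m2 = N)
    (he0 : 2 ≤ e0) (h01 : e0 ≤ e1) (h12 : e1 ≤ e2) (hs : m0 + m1 + m2 = N + 2) :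
    2 * e2 = N ∨ (e0 = 2 ∧ e1 = 3 ∧
      ((e2 = 3 ∧ N = 12) ∨ (e2 = 4 ∧ N = 24) ∨ (e2 = 5 ∧ N = 60))) := by
  have a0 : e0 = 2 := by
    by_contra hne
    have h3 : 3 ≤ e0 := by omega
    have : 3 * m0 ≤ N := by nlinarith
    have : 3 * m1 ≤ N := by nlinarith
    have : 3 * m2 ≤ N := by nlinarith
    omega
  subst a0
  have a1 : e1 < 4 := by
    by_contra hne
    have h3 : 4 ≤ e1 := by omega
    have : 4 * m1 ≤ N := by nlinarith
    have : 4 * m2 ≤ N := by nlinarith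
    omega
  have : e1 = 2 ∨ e1 = 3 := by omega
  rcases this with rfl | rfl
  · left
    have : m2 = 2 := by omega
    subst this
    omega
  · right
    have a2 : e2 < 6 := by
      by_contra hne
      have h3 : 6 ≤ e2 := by omega
      have : 6 * m2 ≤ N := by nlinarith
      omega
    have : e2 = 3 ∨ e2 = 4 ∨ e2 = 5 := by omega
    rcases this with rfl | rfl | rfl <;> omega

open MulAction in
theorem card_stab_of_quot {G X : Type*} [Group G] [MulAction G X] [Finite G] (x y : X)
    (h : (Quotient.mk'' x : Quotient (orbitRel G X)) = Quotient.mk'' y) :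
    Nat.card (stabilizer G x) = Nat.card (stabilizer G y) := by
  have h1 : (orbitRel G X) x y := Quotient.eq''.mp h
  rw [orbitRel_apply] at h1
  exact Nat.card_congr (stabilizerEquivStabilizerOfOrbitRel h1).toEquiv

open MulAction in
theorem count_main {G X : Type*} [Group G] [MulAction G X] [Finite G] [Finite X]
    (hfix : ∀ g : G, g ≠ 1 → Nat.card (fixedBy X g) = 2)
    (hst : ∀ x : X, 2 ≤ Nat.card (stabilizer G x)) :
    Nat.card G = 1 ∨ (∃ x : X, Nat.card (stabilizer G x) = Nat.card G) ∨
    (∃ x : X, 2 * Nat.card (stabilizer G x) = Nat.card G) ∨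
    ∃ k, ((k = 3 ∧ Nat.card G = 12) ∨ (k = 4 ∧ Nat.card G = 24) ∨ (k = 5 ∧ Nat.card G = 60)) ∧
      (∃ x : X, Nat.card (stabilizer G x) = 2) ∧ (∃ x : X, Nat.card (stabilizer G x) = k) ∧
      ∀ x : X, Nat.card (stabilizer G x) = 2 ∨ Nat.card (stabilizer G x) = 3 ∨
        Nat.card (stabilizer G x) = k := by
  classical
  by_cases hN1 : Nat.card G = 1
  · exact Or.inl hN1
  have hNpos : 0 < Nat.card G := Nat.card_pos
  have := Fintype.ofFinite G
  have := Fintype.ofFinite X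
  set Ω := Quotient (orbitRel G X) with hΩ
  have : Fintype Ω := Fintype.ofFinite _
  have burn := sum_card_fixedBy_eq_card_orbits_mul_card_group G X
  have hsum := card_eq_sum_card_group_div_card_stabilizer G X
  set N := Nat.card G with hN
  have hNf : Fintype.card G = N := Fintype.card_eq_nat_card
  set r := Fintype.card Ω with hr
  have hb : Fintype.card X + 2 * (N - 1) = r * N := by
    rw [← hNf, hr, ← burn, ← Finset.add_sum_erase _ _ (Finset.mem_univ (1 : G))]
    congr 1
    · simp
    · rw [Finset.sum_congr rfl (g := fun _ => 2)]
      · simp [mul_comm]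
      · intro g hg
        rw [Fintype.card_eq_nat_card]
        exact hfix g (Finset.ne_of_mem_erase hg)
  let e : Ω → ℕ := fun ω => Nat.card (stabilizer G ω.out)
  have hmul : ∀ ω, e ω * (N / e ω) = N := fun ω =>
    Nat.mul_div_cancel' (Subgroup.card_subgroup_dvd_card _)
  have he2 : ∀ ω, 2 ≤ e ω := fun ω => hst _
  have hsum' : Fintype.card X = ∑ ω : Ω, N / e ω := by
    rw [hsum]
    refine Finset.sum_congr rfl fun ω _ => ?_
    simp only [Fintype.card_eq_nat_card, e, hN]
  have hstab : ∀ x : X, Nat.card (stabilizer G x) = e (Quotient.mk'' x) := by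
    intro x
    apply card_stab_of_quot
    exact (Quotient.out_eq' _).symm
  have hle : 2 * Fintype.card X ≤ r * N := by
    rw [hsum', Finset.mul_sum, hr, ← Finset.card_univ, ← smul_eq_mul]
    apply Finset.sum_le_card_nsmul
    intro ω _
    have := hmul ω
    have := he2 ω
    nlinarith
  have hr3 : r < 4 := by
    by_contra hc
    have : 4 * N ≤ r * N := Nat.mul_le_mul_right _ (by omega)
    omega
  have hex : ∃ f : Fin r ≃ Ω, Monotone (e ∘ f) := by
    let f0 : Fin r ≃ Ω := (Fintype.equivFin Ω).symm
    exact ⟨(Tuple.sort (e ∘ f0)).trans f0, Tuple.monotone_sort (e ∘ f0)⟩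
  obtain ⟨f, hf⟩ := hex
  have hs2 : Fintype.card X = ∑ i, N / e (f i) := by
    rw [hsum', Equiv.sum_comp f (fun ω => N / e ω)]
  have hmpos : ∀ ω, 1 ≤ N / e ω := by
    intro ω
    rcases Nat.eq_zero_or_pos (N / e ω) with h0 | h0
    · have h1 := hmul ω
      rw [h0] at h1
      omega
    · exact h0
  clear_value r
  have : r = 0 ∨ r = 1 ∨ r = 2 ∨ r = 3 := by omega
  rcases this with rfl | rfl | rfl | rfl
  · omega
  · simp at hs2
    have h1 := hmpos (f 0)
    omega
  · simp [Fin.sum_univ_two] at hs2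
    have h1 := hmpos (f 0)
    have h2 := hmpos (f 1)
    have h3 : N / e (f 0) = 1 := by omega
    have h4 := hmul (f 0)
    rw [h3, mul_one] at h4
    exact Or.inr (Or.inl ⟨(f 0).out, h4⟩)
  · rw [Fin.sum_univ_three] at hs2
    have := arith_three N (e (f 0)) (e (f 1)) (e (f 2)) _ _ _ (hmul _) (hmul _) (hmul _)
      (he2 _) (hf (by decide : (0 : Fin 3) ≤ 1)) (hf (by decide : (1 : Fin 3) ≤ 2)) (by omega)
    right; right
    rcases this with h | ⟨a0, a1, a2⟩
    · exact Or.inl ⟨(f 2).out, h⟩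
    · refine Or.inr ⟨e (f 2), a2, ⟨_, a0⟩, ⟨_, rfl⟩, fun x => ?_⟩
      rw [hstab x]
      obtain ⟨i, hi⟩ := f.surjective (Quotient.mk'' x)
      rw [← hi]
      fin_cases i
      · exact Or.inl a0
      · exact Or.inr (Or.inl a1)
      · exact Or.inr (Or.inr rfl)


namespace PGLaux

open OnePoint

variable {K : Type*} [Field K]

/-- The class of an explicit matrix. -/
noncomputable def P (a b c d : K) (h : a * d - b * c ≠ 0) : PGL2 K :=
  QuotientGroup.mk (Matrix.GeneralLinearGroup.mkOfDetNeZero !![a, b; c, d]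
    (by simpa [Matrix.det_fin_two] using h))

theorem P_surj (g : PGL2 K) : ∃ a b c d h, g = P (K := K) a b c d h := by
  obtain ⟨A, rfl⟩ := QuotientGroup.mk_surjective g
  refine ⟨A 0 0, A 0 1, A 1 0, A 1 1, ?_, ?_⟩
  · have := A.det_ne_zero
    rwa [Matrix.det_fin_two] at this
  · unfold P
    congr 1
    ext i j
    fin_cases i <;> fin_cases j <;> rfl

theorem P_eq_iff {a b c d a' b' c' d' : K} {h : a * d - b * c ≠ 0} {h' : a' * d' - b' * c' ≠ 0} :
    P a b c d h = P a' b' c' d' h' ↔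
      ∃ u : K, u ≠ 0 ∧ a' = u * a ∧ b' = u * b ∧ c' = u * c ∧ d' = u * d := by
  unfold P
  rw [QuotientGroup.eq_iff_div_mem, ← inv_mem_iff, inv_div, div_eq_mul_inv,
    Matrix.GeneralLinearGroup.center_eq_range_scalar]
  constructor
  · rintro ⟨u, hu⟩
    refine ⟨u, u.ne_zero, ?_⟩
    rw [eq_mul_inv_iff_mul_eq] at hu
    have hu' := fun i j => congrFun (congrFun (congrArg (fun x : GL (Fin 2) K => x.val) hu) i) j
    have h00 := hu' 0 0
    have h01 := hu' 0 1
    have h10 := hu' 1 0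
    have h11 := hu' 1 1
    simp [Matrix.mul_apply, Fin.sum_univ_two, Matrix.GeneralLinearGroup.mkOfDetNeZero] at h00 h01 h10 h11
    exact ⟨h00.symm, h01.symm, h10.symm, h11.symm⟩
  · rintro ⟨u, hu, rfl, rfl, rfl, rfl⟩
    refine ⟨Units.mk0 u hu, ?_⟩
    rw [eq_mul_inv_iff_mul_eq]
    ext i j
    fin_cases i <;> fin_cases j <;>
      simp [Matrix.mul_apply, Fin.sum_univ_two, Matrix.GeneralLinearGroup.mkOfDetNeZero]

theorem P_one : (1 : PGL2 K) = P 1 0 0 1 (by simp) := by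
  unfold P
  rw [← QuotientGroup.mk_one]
  congr 1
  ext i j
  fin_cases i <;> fin_cases j <;> simp [Matrix.GeneralLinearGroup.mkOfDetNeZero]

theorem P_mul {a b c d a' b' c' d' : K} (h : a * d - b * c ≠ 0) (h' : a' * d' - b' * c' ≠ 0) :
    P a b c d h * P a' b' c' d' h' =
      P (a * a' + b * c') (a * b' + b * d') (c * a' + d * c') (c * b' + d * d')
        (by have := mul_ne_zero h h'; intro h0; apply this; linear_combination h0) := by
  unfold P
  rw [← QuotientGroup.mk_mul]
  congr 1
  ext i j
  fin_cases i <;> fin_cases j <;>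
      simp [Matrix.mul_apply, Fin.sum_univ_two, Matrix.GeneralLinearGroup.mkOfDetNeZero]

theorem P_eq_one_iff {a b c d : K} {h : a * d - b * c ≠ 0} :
    P a b c d h = 1 ↔ b = 0 ∧ c = 0 ∧ a = d := by
  rw [P_one, eq_comm, P_eq_iff]
  constructor
  · rintro ⟨u, hu, rfl, rfl, rfl, rfl⟩
    simp
  · rintro ⟨rfl, rfl, rfl⟩
    have : a ≠ 0 := by rintro rfl; simp at h
    exact ⟨a, this, by simp⟩

theorem P_inv {a b c d : K} (h : a * d - b * c ≠ 0) :
    (P a b c d h)⁻¹ = P d (-b) (-c) a (by intro h0; apply h; linear_combination h0) := by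
  symm
  apply eq_inv_of_mul_eq_one_left
  rw [P_mul, P_eq_one_iff]
  refine ⟨by ring, by ring, by ring⟩

/-- the torus -/
noncomputable def δ : Kˣ →* PGL2 K where
  toFun t := P (t : K) 0 0 1 (by simp)
  map_one' := by rw [P_eq_one_iff]; simp
  map_mul' s t := by
    rw [P_mul, P_eq_iff]
    exact ⟨1, one_ne_zero, by simp⟩

theorem δ_apply (t : Kˣ) : δ t = P (t : K) 0 0 1 (by simp) := rfl

theorem δ_inj : Function.Injective (δ : Kˣ → PGL2 K) := by
  rw [injective_iff_map_eq_one]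
  intro t ht
  rw [δ_apply, P_eq_one_iff] at ht
  ext
  simpa using ht.2.2

theorem ord2 {a b c d : K} {h : a * d - b * c ≠ 0} (h2 : P a b c d h ^ 2 = 1)
    (h1 : P a b c d h ≠ 1) : a + d = 0 := by
  rw [pow_two, P_mul, P_eq_one_iff] at h2
  rw [ne_eq, P_eq_one_iff] at h1
  obtain ⟨e1, e2, e3⟩ := h2
  by_contra hne
  apply h1
  refine ⟨?_, ?_, ?_⟩
  · apply mul_left_cancel₀ hne; linear_combination e1
  · apply mul_left_cancel₀ hne; linear_combination e2
  · apply mul_left_cancel₀ hne; linear_combination e3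

theorem ord3 {a b c d : K} {h : a * d - b * c ≠ 0} (h2 : P a b c d h ^ 3 = 1)
    (h1 : P a b c d h ≠ 1) : (a + d) ^ 2 = a * d - b * c := by
  rw [pow_succ, pow_two, P_mul, P_mul, P_eq_one_iff] at h2
  rw [ne_eq, P_eq_one_iff] at h1
  obtain ⟨e1, e2, e3⟩ := h2
  by_contra hne
  rw [← sub_eq_zero] at hne
  apply h1
  refine ⟨?_, ?_, ?_⟩
  · apply mul_left_cancel₀ hne; linear_combination e1
  · apply mul_left_cancel₀ hne; linear_combination e2
  · apply mul_left_cancel₀ hne; linear_combination e3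

theorem ord4 {a b c d : K} {h : a * d - b * c ≠ 0} (h2 : P a b c d h ^ 4 = 1)
    (h1 : P a b c d h ≠ 1) : (a + d) = 0 ∨ (a + d) ^ 2 = 2 * (a * d - b * c) := by
  rw [pow_succ, pow_succ, pow_two, P_mul, P_mul, P_mul, P_eq_one_iff] at h2
  rw [ne_eq, P_eq_one_iff] at h1
  obtain ⟨e1, e2, e3⟩ := h2
  by_contra! hne
  obtain ⟨hn1, hn2⟩ := hne
  rw [← sub_ne_zero] at hn2
  have hne := mul_ne_zero hn1 hn2
  apply h1
  refine ⟨?_, ?_, ?_⟩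
  · apply mul_left_cancel₀ hne; linear_combination e1
  · apply mul_left_cancel₀ hne; linear_combination e2
  · apply mul_left_cancel₀ hne; linear_combination e3

theorem ord5 {a b c d : K} {h : a * d - b * c ≠ 0} (h2 : P a b c d h ^ 5 = 1)
    (h1 : P a b c d h ≠ 1) :
    (a + d) ^ 4 - 3 * (a + d) ^ 2 * (a * d - b * c) + (a * d - b * c) ^ 2 = 0 := by
  rw [pow_succ, pow_succ, pow_succ, pow_two, P_mul, P_mul, P_mul, P_mul, P_eq_one_iff] at h2
  rw [ne_eq, P_eq_one_iff] at h1
  obtain ⟨e1, e2, e3⟩ := h2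
  by_contra hne
  apply h1
  refine ⟨?_, ?_, ?_⟩
  · apply mul_left_cancel₀ hne; linear_combination e1
  · apply mul_left_cancel₀ hne; linear_combination e2
  · apply mul_left_cancel₀ hne; linear_combination e3

theorem unip_pow (b : K) (n : ℕ) : P 1 b 0 1 (by simp) ^ n = P 1 (n * b) 0 1 (by simp) := by
  induction n with
  | zero => rw [pow_zero, eq_comm, P_eq_one_iff]; simp
  | succ n ih =>
    rw [pow_succ, ih, P_mul, P_eq_iff]
    exact ⟨1, one_ne_zero, by simp, by push_cast; ring, by simp, by simp⟩

theorem unip [CharZero K] {a b : K} {h : a * a - b * 0 ≠ 0} {n : ℕ} (hn : 0 < n)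
    (hp : P a b 0 a h ^ n = 1) : P a b 0 a h = 1 := by
  have ha : a ≠ 0 := by rintro rfl; simp at h
  have : P a b 0 a h = P 1 (b / a) 0 1 (by simp) := by
    rw [P_eq_iff]
    exact ⟨a⁻¹, inv_ne_zero ha, by field_simp, by field_simp, by simp, by field_simp⟩
  rw [this, unip_pow, P_eq_one_iff] at hp
  rw [this, P_eq_one_iff]
  have hn' : (n : K) ≠ 0 := by exact_mod_cast hn.ne'
  simpa [hn'] using hp

section action
variable [DecidableEq K]

noncomputable instance actPGL : MulAction (PGL2 K) (OnePoint K) :=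
  MulAction.compHom (OnePoint K) (QuotientGroup.lift (Subgroup.center (GL (Fin 2) K))
    (MulAction.toPermHom (GL (Fin 2) K) (OnePoint K)) (by
      intro A hA
      rw [Matrix.GeneralLinearGroup.center_eq_range_scalar] at hA
      obtain ⟨u, rfl⟩ := hA
      ext x
      simp only [MulAction.toPermHom_apply, MulAction.toPerm_apply, Equiv.Perm.coe_one, id]
      cases x with
      | infty => simp [smul_infty_eq_ite]
      | coe z =>
        simp [smul_some_eq_ite]))

theorem mk_smul (A : GL (Fin 2) K) (x : OnePoint K) :
    ((QuotientGroup.mk A : PGL2 K)) • x = A • x := rfl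

theorem P_infty {a b c d : K} (h : a * d - b * c ≠ 0) :
    P a b c d h • (∞ : OnePoint K) = if c = 0 then ∞ else ((a / c : K) : OnePoint K) := by
  unfold P
  rw [mk_smul, smul_infty_eq_ite]
  simp [Matrix.GeneralLinearGroup.mkOfDetNeZero]

theorem P_coe {a b c d : K} (h : a * d - b * c ≠ 0) (z : K) :
    P a b c d h • (z : OnePoint K) =
      if c * z + d = 0 then ∞ else (((a * z + b) / (c * z + d) : K) : OnePoint K) := by
  unfold P
  rw [mk_smul, smul_some_eq_ite]
  simp [Matrix.GeneralLinearGroup.mkOfDetNeZero]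

theorem P_infty_fix {a b c d : K} (h : a * d - b * c ≠ 0) :
    P a b c d h • (∞ : OnePoint K) = ∞ ↔ c = 0 := by
  rw [P_infty]; simp

theorem P_zero_fix {a b c d : K} (h : a * d - b * c ≠ 0) :
    P a b c d h • ((0 : K) : OnePoint K) = (0 : K) ↔ b = 0 := by
  rw [P_coe]
  by_cases hd : d = 0
  · have : b ≠ 0 := by rintro rfl; simp [hd] at h
    simp [hd, this]
  · simp [hd]

theorem P_infty_zero {a b c d : K} (h : a * d - b * c ≠ 0) :
    P a b c d h • (∞ : OnePoint K) = (0 : K) ↔ a = 0 := by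
  rw [P_infty]
  by_cases hc : c = 0
  · have : a ≠ 0 := by rintro rfl; simp [hc] at h
    simp [hc, this]
  · simp [hc]

theorem P_zero_infty {a b c d : K} (h : a * d - b * c ≠ 0) :
    P a b c d h • ((0 : K) : OnePoint K) = ∞ ↔ d = 0 := by
  rw [P_coe]
  simp

theorem δ_fix (t : Kˣ) (ht : t ≠ 1) (x : OnePoint K) :
    δ t • x = x ↔ x = ((0 : K) : OnePoint K) ∨ x = ∞ := by
  rw [δ_apply]
  cases x with
  | infty => simp [P_infty]
  | coe z =>
    rw [P_coe]
    have : (t : K) ≠ 1 := by simpa using ht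
    simp
    constructor
    · intro hz
      by_contra hz0
      apply this
      apply mul_right_cancel₀ hz0
      rw [hz, one_mul]
    · rintro rfl; simp

theorem trans_infty (x : OnePoint K) : ∃ h : PGL2 K, h • x = ∞ := by
  cases x with
  | infty => exact ⟨1, one_smul _ _⟩
  | coe z => exact ⟨P 0 1 1 (-z) (by simp), by rw [P_coe]; simp⟩

theorem exists_fix [IsAlgClosed K] (g : PGL2 K) : ∃ x : OnePoint K, g • x = x := by
  obtain ⟨a, b, c, d, h, rfl⟩ := P_surj g
  by_cases hc : c = 0
  · exact ⟨∞, by rw [P_infty_fix]; exact hc⟩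
  · obtain ⟨z, hz⟩ := IsAlgClosed.exists_root
      (Polynomial.C c * Polynomial.X ^ 2 + Polynomial.C (d - a) * Polynomial.X + Polynomial.C (-b))
      (by rw [Polynomial.degree_quadratic hc]; decide)
    simp at hz
    refine ⟨z, ?_⟩
    rw [P_coe]
    have hne : c * z + d ≠ 0 := by
      intro h0
      have h1 : a * z + b = 0 := by linear_combination z * h0 - hz
      apply h
      have hd : d = - c * z := by linear_combination h0
      have hb : b = - a * z := by linear_combination h1
      rw [hd, hb]; ring
    rw [if_neg hne]
    congr 1
    rw [div_eq_iff hne]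
    linear_combination -hz

theorem conj_diag [IsAlgClosed K] [CharZero K] (g : PGL2 K) (hg : IsOfFinOrder g) :
    ∃ (h : PGL2 K) (t : Kˣ), h * g * h⁻¹ = δ t := by
  obtain ⟨x, hx⟩ := exists_fix g
  obtain ⟨h, hh⟩ := trans_infty x
  have hfix : (h * g * h⁻¹) • (∞ : OnePoint K) = ∞ := by
    rw [← hh, mul_smul, mul_smul, inv_smul_smul, hx]
  have hfin : IsOfFinOrder (h * g * h⁻¹) := by
    have := (MulAut.conj h).toMonoidHom.isOfFinOrder hg
    simpa using this
  obtain ⟨a, b, c, d, hdet, hP⟩ := P_surj (h * g * h⁻¹)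
  rw [hP] at hfix hfin
  rw [P_infty_fix] at hfix
  subst hfix
  have ha : a ≠ 0 := by rintro rfl; simp at hdet
  have hd : d ≠ 0 := by rintro rfl; simp at hdet
  by_cases had : a = d
  · subst had
    obtain ⟨n, hn, hn1⟩ := hfin.exists_pow_eq_one
    refine ⟨h, 1, ?_⟩
    rw [hP, map_one, unip hn hn1]
  · have hsub : a - d ≠ 0 := sub_ne_zero.mpr had
    refine ⟨P 1 (b / (a - d)) 0 1 (by simp) * h, Units.mk0 (a / d) (div_ne_zero ha hd), ?_⟩
    have hconj : ∀ u : PGL2 K, (u * h) * g * (u * h)⁻¹ = u * (h * g * h⁻¹) * u⁻¹ := by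
      intro u; group
    rw [hconj, hP, mul_inv_eq_iff_eq_mul, δ_apply, P_mul, P_mul, P_eq_iff]
    refine ⟨d⁻¹, inv_ne_zero hd, ?_, ?_, ?_, ?_⟩
    · simp; field_simp
    · simp; field_simp; ring
    · simp
    · simp; field_simp

theorem fix_two [IsAlgClosed K] [CharZero K] (g : PGL2 K) (hg : IsOfFinOrder g) (h1 : g ≠ 1) :
    ∃ p q : OnePoint K, p ≠ q ∧ ∀ x, g • x = x ↔ x = p ∨ x = q := by
  obtain ⟨h, t, ht⟩ := conj_diag g hg
  have ht1 : t ≠ 1 := by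
    rintro rfl
    rw [map_one, mul_inv_eq_one] at ht
    exact h1 (by simpa using ht)
  refine ⟨h⁻¹ • ((0 : K) : OnePoint K), h⁻¹ • (∞ : OnePoint K), ?_, ?_⟩
  · intro h0
    exact OnePoint.coe_ne_infty _ (MulAction.injective _ h0)
  · intro x
    rw [eq_inv_smul_iff, eq_inv_smul_iff, ← δ_fix t ht1, ← ht, mul_smul, mul_smul, inv_smul_smul]
    exact (MulAction.injective h).eq_iff.symm

theorem cyclic_of_fix [CharZero K] (F : Subgroup (PGL2 K)) [Finite F] (p : OnePoint K)
    (hp : ∀ g ∈ F, g • p = p) : IsCyclic F := by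
  obtain ⟨h, hh⟩ := trans_infty p
  have key : ∀ g : F, ∃ (a b : K) (ha : a ≠ 0), h * (g : PGL2 K) * h⁻¹ = P a b 0 1 (by simpa using ha) := by
    intro g
    have hfix : (h * (g : PGL2 K) * h⁻¹) • (∞ : OnePoint K) = ∞ := by
      rw [← hh, mul_smul, mul_smul, inv_smul_smul, hp g g.2]
    obtain ⟨a, b, c, d, hdet, hP⟩ := P_surj (h * (g : PGL2 K) * h⁻¹)
    rw [hP, P_infty_fix] at hfix
    subst hfix
    have ha : a ≠ 0 := by rintro rfl; simp at hdet
    have hd : d ≠ 0 := by rintro rfl; simp at hdet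
    refine ⟨a / d, b / d, div_ne_zero ha hd, ?_⟩
    rw [hP, P_eq_iff]
    exact ⟨d⁻¹, inv_ne_zero hd, by field_simp, by field_simp, by simp, by field_simp⟩
  choose a b ha hab using key
  let f : F →* K :=
    { toFun := a
      map_one' := by
        have := hab 1
        simp only [OneMemClass.coe_one, mul_one, mul_inv_cancel] at this
        exact (P_eq_one_iff.mp this.symm).2.2
      map_mul' := by
        intro x y
        have h1 := hab (x * y)
        have h2 : h * ((x : PGL2 K) * (y : PGL2 K)) * h⁻¹ = (h * (x : PGL2 K) * h⁻¹) * (h * (y : PGL2 K) * h⁻¹) := by group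
        rw [Subgroup.coe_mul, h2, hab, hab, P_mul, P_eq_iff] at h1
        obtain ⟨u, hu, e1, e2, e3, e4⟩ := h1
        simp at e4
        rw [e1, ← e4]; simp }
  apply isCyclic_of_injective_ringHom f
  rw [injective_iff_map_eq_one]
  intro g hg
  have hg' : a g = 1 := hg
  obtain ⟨n, hn, hn1⟩ := (isOfFinOrder_of_finite g).exists_pow_eq_one
  have h1 := hab g
  have h2 : (h * (g : PGL2 K) * h⁻¹) ^ n = 1 := by
    rw [conj_pow]
    have : (g : PGL2 K) ^ n = 1 := by exact_mod_cast congrArg Subtype.val hn1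
    rw [this]; simp
  simp only [hg'] at h1
  rw [h1] at h2
  rw [unip hn h2, mul_inv_eq_one] at h1
  ext
  simpa using h1

end action
end PGLaux

namespace PGLaux
open OnePoint

variable {K : Type*} [Field K]

/-- conjugate subgroup -/
def cj (h : PGL2 K) (G : Subgroup (PGL2 K)) : Subgroup (PGL2 K) :=
  G.map (MulAut.conj h).toMonoidHom

def Cyc (G : Subgroup (PGL2 K)) : Prop := ∃ g ∈ G, orderOf g = Nat.card G
def Dih (G : Subgroup (PGL2 K)) : Prop := ∃ g ∈ G, 2 * orderOf g = Nat.card G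

theorem mem_cj {h : PGL2 K} {G : Subgroup (PGL2 K)} {x : PGL2 K} (hx : x ∈ G) :
    h * x * h⁻¹ ∈ cj h G := ⟨x, hx, by simp⟩

theorem card_cj (h : PGL2 K) (G : Subgroup (PGL2 K)) : Nat.card (cj h G) = Nat.card G :=
  Subgroup.card_map_of_injective (MulAut.conj h).injective

instance finite_cj (h : PGL2 K) (G : Subgroup (PGL2 K)) [Finite G] : Finite (cj h G) :=
  Nat.finite_of_card_ne_zero (by rw [card_cj]; exact Nat.card_pos.ne')

theorem cj_cj (h h' : PGL2 K) (G : Subgroup (PGL2 K)) : cj h' (cj h G) = cj (h' * h) G := by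
  unfold cj
  rw [Subgroup.map_map]
  congr 1
  ext x
  simp

theorem orderOf_conj' (h x : PGL2 K) : orderOf (h * x * h⁻¹) = orderOf x := by
  have := orderOf_injective (MulAut.conj h).toMonoidHom (MulAut.conj h).injective x
  simpa using this

theorem Cyc_cj {h : PGL2 K} {G : Subgroup (PGL2 K)} (hc : Cyc (cj h G)) : Cyc G := by
  obtain ⟨g, ⟨x, hx, rfl⟩, hg⟩ := hc
  refine ⟨x, hx, ?_⟩
  rw [card_cj] at hg
  rw [← hg]
  simpa using (orderOf_conj' h x).symm

theorem Dih_cj {h : PGL2 K} {G : Subgroup (PGL2 K)} (hc : Dih (cj h G)) : Dih G := by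
  obtain ⟨g, ⟨x, hx, rfl⟩, hg⟩ := hc
  refine ⟨x, hx, ?_⟩
  rw [card_cj] at hg
  rw [← hg]
  simpa using (orderOf_conj' h x).symm

theorem norm2 {G H : Subgroup (PGL2 K)} [Finite G] (hle : H ≤ G)
    (hcard : 2 * Nat.card H = Nat.card G) {g x : PGL2 K} (hg : g ∈ G) (hx : x ∈ H) :
    g * x * g⁻¹ ∈ H := by
  have hi : (H.subgroupOf G).index = 2 := by
    have h1 := (H.subgroupOf G).card_mul_index
    have h2 : Nat.card (H.subgroupOf G) = Nat.card H :=
      Nat.card_congr (Subgroup.subgroupOfEquivOfLe hle).toEquiv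
    have h3 : 0 < Nat.card G := Nat.card_pos
    rw [h2, ← hcard, mul_comm 2] at h1
    exact Nat.eq_of_mul_eq_mul_left (by omega) h1
  have hn := Subgroup.normal_of_index_eq_two hi
  have := hn.conj_mem ⟨x, hle hx⟩ (by simpa [Subgroup.mem_subgroupOf] using hx) ⟨g, hg⟩
  simpa [Subgroup.mem_subgroupOf] using this

theorem fin_order {G : Subgroup (PGL2 K)} [Finite G] {g : PGL2 K} (hg : g ∈ G) :
    IsOfFinOrder g := by
  have := isOfFinOrder_of_finite (⟨g, hg⟩ : G)
  exact G.subtype.isOfFinOrder this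

theorem orderOf_δ {ζ : Kˣ} {n : ℕ} (hζ : IsPrimitiveRoot ζ n) : orderOf (δ ζ) = n := by
  rw [orderOf_injective δ δ_inj, hζ.eq_orderOf]

section action
variable [DecidableEq K]

/-- the stabilizer of a point is generated by a single element -/
theorem stab_gen [CharZero K] (G : Subgroup (PGL2 K)) [Finite G] (x : OnePoint K) :
    ∃ c ∈ G, c • x = x ∧ orderOf c = Nat.card (MulAction.stabilizer G x) ∧
      ∀ g ∈ G, g • x = x → g ∈ Subgroup.zpowers c := by
  let F : Subgroup (PGL2 K) := (MulAction.stabilizer G x).map G.subtype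
  have hF : ∀ g, g ∈ F ↔ g ∈ G ∧ g • x = x := by
    intro g
    constructor
    · rintro ⟨y, hy, rfl⟩
      exact ⟨y.2, hy⟩
    · rintro ⟨h1, h2⟩
      exact ⟨⟨g, h1⟩, h2, rfl⟩
  have hFfin : Finite F := by
    apply Nat.finite_of_card_ne_zero
    rw [Subgroup.card_map_of_injective G.subtype_injective]
    exact Nat.card_pos.ne'
  have hc : IsCyclic F := cyclic_of_fix F x fun g hg => ((hF g).1 hg).2
  obtain ⟨c, hc⟩ := hc.exists_generator
  have h1 := (hF c).1 c.2
  refine ⟨c, h1.1, h1.2, ?_, ?_⟩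
  · rw [Subgroup.orderOf_coe, orderOf_eq_card_of_forall_mem_zpowers hc]
    exact Subgroup.card_map_of_injective G.subtype_injective
  · intro g hg hgx
    have := hc ⟨g, (hF g).2 ⟨hg, hgx⟩⟩
    obtain ⟨i, hi⟩ := this
    exact ⟨i, by simpa using congrArg Subtype.val hi⟩

/-- numerical data of the polyhedral groups -/
def Data (k : ℕ) (G : Subgroup (PGL2 K)) : Prop :=
  ((k = 3 ∧ Nat.card G = 12) ∨ (k = 4 ∧ Nat.card G = 24) ∨ (k = 5 ∧ Nat.card G = 60)) ∧
  (∃ x : OnePoint K, Nat.card (MulAction.stabilizer G x) = 2) ∧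
  (∃ x : OnePoint K, Nat.card (MulAction.stabilizer G x) = k) ∧
  ∀ (x : OnePoint K) (g : PGL2 K), g ∈ G → g ≠ 1 → g • x = x →
    Nat.card (MulAction.stabilizer G x) = 2 ∨ Nat.card (MulAction.stabilizer G x) = 3 ∨
        Nat.card (MulAction.stabilizer G x) = k

theorem classify [IsAlgClosed K] [CharZero K] (G : Subgroup (PGL2 K)) [Finite G] :
    Cyc G ∨ Dih G ∨ ∃ k, Data k G := by
  let X : SubMulAction G (OnePoint K) :=
    { carrier := {x | ∃ g : G, g ≠ 1 ∧ g • x = x}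
      smul_mem' := by
        rintro h x ⟨g, hg, hgx⟩
        refine ⟨h * g * h⁻¹, ?_, ?_⟩
        · simpa using hg
        · rw [mul_smul, mul_smul, inv_smul_smul, hgx] }
  have hmemX : ∀ x, x ∈ X ↔ ∃ g : G, g ≠ 1 ∧ g • x = x := fun x => Iff.rfl
  have hft : ∀ g : G, g ≠ 1 → ∃ p q : OnePoint K, p ≠ q ∧ ∀ x, g • x = x ↔ x = p ∨ x = q := by
    intro g hg
    exact fix_two (g : PGL2 K) (fin_order g.2) (by simpa using hg)
  have hfinX : Finite X := by
    have : (X : Set (OnePoint K)) ⊆ ⋃ g : {g : G // g ≠ 1}, {x | g.1 • x = x} := by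
      rintro x ⟨g, hg, hgx⟩
      exact Set.mem_iUnion.2 ⟨⟨g, hg⟩, hgx⟩
    refine Set.Finite.subset (Set.finite_iUnion ?_) this
    rintro ⟨g, hg⟩
    obtain ⟨p, q, -, h⟩ := hft g hg
    refine Set.Finite.subset (Set.toFinite {p, q}) ?_
    intro x hx
    exact (h x).1 hx
  have hstabX : ∀ x : X, MulAction.stabilizer G x = MulAction.stabilizer G (x : OnePoint K) :=
    fun x => SubMulAction.stabilizer_of_subMul x
  have := count_main (G := G) (X := X) (by
    intro g hg
    obtain ⟨p, q, hpq, h⟩ := hft g hg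
    have hp : p ∈ X := ⟨g, hg, (h p).2 (Or.inl rfl)⟩
    have hq : q ∈ X := ⟨g, hg, (h q).2 (Or.inr rfl)⟩
    have : MulAction.fixedBy X g = {⟨p, hp⟩, ⟨q, hq⟩} := by
      ext x
      rw [MulAction.mem_fixedBy, Subtype.ext_iff]
      have := h x
      simp only [Set.mem_insert_iff, Set.mem_singleton_iff, Subtype.ext_iff]
      exact this
    rw [this, Nat.card_coe_set_eq, Set.ncard_pair]
    simpa [Subtype.ext_iff] using hpq) (by
    intro x
    obtain ⟨g, hg, hgx⟩ := (hmemX x).1 x.2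
    rw [hstabX]
    have : Nontrivial (MulAction.stabilizer G (x : OnePoint K)) :=
      ⟨⟨⟨g, hgx⟩, 1, fun h0 => hg (congrArg Subtype.val h0)⟩⟩
    exact Finite.one_lt_card)
  simp only [hstabX] at this
  rcases this with h | ⟨x, h⟩ | ⟨x, h⟩ | ⟨k, h1, ⟨x2, h2⟩, ⟨x3, h3⟩, h4⟩
  · left
    exact ⟨1, G.one_mem, by rw [h, orderOf_one]⟩
  · left
    obtain ⟨c, hc, -, h1, -⟩ := stab_gen G (x : OnePoint K)
    exact ⟨c, hc, h1.trans h⟩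
  · right; left
    obtain ⟨c, hc, -, h1, -⟩ := stab_gen G (x : OnePoint K)
    exact ⟨c, hc, by rw [h1, h]⟩
  · right; right
    refine ⟨k, h1, ⟨x2, h2⟩, ⟨x3, h3⟩, ?_⟩
    intro x g hg hg1 hgx
    exact h4 ⟨x, ⟨⟨g, hg⟩, by simpa [Subtype.ext_iff] using hg1, hgx⟩⟩

theorem Data.pow [IsAlgClosed K] [CharZero K] {k : ℕ} {G : Subgroup (PGL2 K)} [Finite G]
    (hD : Data k G) {g : PGL2 K} (hg : g ∈ G) : g ^ 2 = 1 ∨ g ^ 3 = 1 ∨ g ^ k = 1 := by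
  by_cases h1 : g = 1
  · simp [h1]
  obtain ⟨x, hx⟩ := exists_fix g
  have hm : g ^ Nat.card (MulAction.stabilizer G x) = 1 := by
    have := pow_card_eq_one' (x := (⟨⟨g, hg⟩, hx⟩ : MulAction.stabilizer G x))
    simpa [Subtype.ext_iff] using this
  rcases hD.2.2.2 x g hg h1 hx with h | h | h <;> rw [h] at hm <;> simp [hm]

/-- normalising one element -/
theorem conj_to_δ [IsAlgClosed K] [CharZero K] (G : Subgroup (PGL2 K)) [Finite G] {c : PGL2 K}
    (hc : c ∈ G) {n : ℕ} (hn : orderOf c = n) {ζ : Kˣ} (hζ : IsPrimitiveRoot ζ n) :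
    ∃ h, δ ζ ∈ cj h G := by
  obtain ⟨h, t, ht⟩ := conj_diag c (fin_order hc)
  refine ⟨h, ?_⟩
  have hpos : 0 < n := by rw [← hn]; exact (fin_order hc).orderOf_pos
  have hto : orderOf t = n := by
    rw [← orderOf_injective δ δ_inj, ← ht, orderOf_conj', hn]
  have : NeZero n := ⟨hpos.ne'⟩
  have htp : IsPrimitiveRoot t n := hto ▸ IsPrimitiveRoot.orderOf t
  obtain ⟨i, -, hi⟩ := (htp.map_of_injective (f := Units.coeHom K) Units.val_injective).eq_pow_of_pow_eq_one
    (ξ := (ζ : K)) (by rw [← Units.val_pow_eq_pow_val, hζ.pow_eq_one, Units.val_one])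
  have hi' : t ^ i = ζ := by ext; simpa using hi
  rw [← hi', map_pow, ← ht]
  exact pow_mem (mem_cj hc) i

theorem cyc_nf [IsAlgClosed K] [CharZero K] (G : Subgroup (PGL2 K)) [Finite G] (hC : Cyc G)
    {ζ : Kˣ} (hζ : IsPrimitiveRoot ζ (Nat.card G)) :
    ∃ h, cj h G = Subgroup.zpowers (δ ζ) := by
  obtain ⟨c, hc, ho⟩ := hC
  obtain ⟨h, hh⟩ := conj_to_δ G hc ho hζ
  refine ⟨h, ?_⟩
  symm
  apply Subgroup.eq_of_le_of_card_ge
  · simpa using hh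
  · rw [card_cj, Nat.card_zpowers, orderOf_δ hζ]

theorem δ_comm (s t : Kˣ) : δ s * δ t * (δ s)⁻¹ = δ t := by
  rw [← map_mul, mul_comm, map_mul, mul_inv_cancel_right]

theorem δ_conj (s : Kˣ) {a b c d : K} (h : a * d - b * c ≠ 0) :
    δ s * P a b c d h * (δ s)⁻¹ = P a (s * b) (c / s) d (by
      have : (s : K) ≠ 0 := s.ne_zero
      field_simp; exact h) := by
  rw [mul_inv_eq_iff_eq_mul, δ_apply, P_mul, P_mul, P_eq_iff]
  have : (s : K) ≠ 0 := s.ne_zero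
  exact ⟨1, one_ne_zero, by simp [mul_comm], by simp, by simp, by simp⟩

/-- the Weyl element -/
noncomputable def w : PGL2 K := P 0 1 1 0 (by simp)

theorem dih_nf [IsAlgClosed K] [CharZero K] (G : Subgroup (PGL2 K)) [Finite G] (hD : Dih G)
    (hC : ¬ Cyc G) {n : ℕ} (hn : 2 * n = Nat.card G) {ζ : Kˣ} (hζ : IsPrimitiveRoot ζ n) :
    ∃ h, cj h G = Subgroup.closure {δ ζ, w} := by
  obtain ⟨c, hc, ho⟩ := hD
  have hon : orderOf c = n := by omega
  obtain ⟨h, hh⟩ := conj_to_δ G hc hon hζ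
  have hNpos : 0 < Nat.card G := Nat.card_pos
  have hζ1 : ζ ≠ 1 := by
    rintro rfl
    apply hC
    have h1 : n = 1 := by simpa using hζ.eq_orderOf
    have : Fact (Nat.Prime 2) := ⟨Nat.prime_two⟩
    have : IsCyclic G := isCyclic_of_prime_card (p := 2) (by omega)
    obtain ⟨g, hg⟩ := this.exists_generator
    exact ⟨g, g.2, by rw [Subgroup.orderOf_coe, orderOf_eq_card_of_forall_mem_zpowers hg]⟩
  have hζ1' : (ζ : K) ≠ 1 := by simpa using hζ1
  have hex : ∃ g ∈ cj h G, g • (∞ : OnePoint K) ≠ ∞ := by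
    by_contra! hcon
    have := cyclic_of_fix (cj h G) ∞ hcon
    obtain ⟨g, hg⟩ := this.exists_generator
    apply hC
    apply Cyc_cj (h := h)
    exact ⟨g, g.2, by rw [Subgroup.orderOf_coe, orderOf_eq_card_of_forall_mem_zpowers hg]⟩
  obtain ⟨g, hg, hginf⟩ := hex
  have hnorm : g * δ ζ * g⁻¹ ∈ Subgroup.zpowers (δ ζ) :=
    norm2 (G := cj h G) (H := Subgroup.zpowers (δ ζ)) (by simpa using hh)
      (by rw [card_cj, Nat.card_zpowers, orderOf_δ hζ, hn]) hg (Subgroup.mem_zpowers _)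
  obtain ⟨i, hi⟩ := hnorm
  obtain ⟨a, b, c, d, hdet, rfl⟩ := P_surj g
  rw [ne_eq, P_infty_fix] at hginf
  simp only [← map_zpow] at hi
  rw [eq_mul_inv_iff_mul_eq] at hi
  generalize ζ ^ i = ξ at hi
  rw [δ_apply, δ_apply, P_mul, P_mul, P_eq_iff] at hi
  obtain ⟨u, hu, e1, e2, e3, e4⟩ := hi
  simp at e1 e2 e3 e4
  have hd : d = 0 := by
    by_contra hd
    have hu1 : u = 1 := by
      apply mul_right_cancel₀ hd; rw [one_mul]; exact e4.symm
    rw [hu1] at e3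
    apply hζ1'
    apply mul_left_cancel₀ hginf
    rw [e3]; ring
  subst hd
  have hb : b ≠ 0 := by rintro rfl; simp at hdet
  have ha : a = 0 := by
    by_contra ha
    have h1 : u * ξ = 1 := by
      apply mul_right_cancel₀ hb; rw [mul_assoc, ← e2, one_mul]
    apply hζ1'
    apply mul_left_cancel₀ ha
    rw [e1, ← mul_assoc, h1]; ring
  subst ha
  obtain ⟨s0, hs0⟩ := IsAlgClosed.exists_eq_mul_self (c / b)
  have hs0n : s0 ≠ 0 := by
    rintro rfl
    rw [mul_zero] at hs0
    exact div_ne_zero hginf hb hs0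
  have hs0' : c = s0 * s0 * b := by rw [← hs0]; field_simp
  let s : Kˣ := Units.mk0 s0 hs0n
  have hs := mem_cj (h := δ s) hg
  have hs2 := mem_cj (h := δ s) hh
  rw [cj_cj] at hs hs2
  rw [δ_conj] at hs
  rw [δ_comm] at hs2
  have hw : w ∈ cj (δ s * h) G := by
    convert hs using 1
    unfold w
    rw [P_eq_iff]
    exact ⟨s0 * b, mul_ne_zero hs0n hb, by simp, by simp [s], by rw [hs0']; simp [s]; field_simp, by simp⟩
  refine ⟨δ s * h, ?_⟩
  symm
  apply Subgroup.eq_of_le_of_card_ge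
  · rw [Subgroup.closure_le]
    rintro x (rfl | rfl)
    · exact hs2
    · exact hw
  · have hle : Subgroup.closure {δ ζ, w} ≤ cj (δ s * h) G := by
      rw [Subgroup.closure_le]
      rintro x (rfl | rfl)
      · exact hs2
      · exact hw
    have hzle : Subgroup.zpowers (δ ζ) ≤ Subgroup.closure {δ ζ, w} := by
      rw [Subgroup.zpowers_le]
      exact Subgroup.subset_closure (by simp)
    have hfin : Finite (Subgroup.closure {δ ζ, w} : Subgroup (PGL2 K)) :=
      Finite.of_injective _ (Subgroup.inclusion_injective hle)
    have hdvd := Subgroup.card_dvd_of_le hzle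
    rw [Nat.card_zpowers, orderOf_δ hζ] at hdvd
    obtain ⟨m, hm⟩ := hdvd
    rw [card_cj, ← hn, hm, mul_comm 2]
    apply Nat.mul_le_mul_left
    by_contra hlt
    have hpos : 0 < Nat.card (Subgroup.closure {δ ζ, w} : Subgroup (PGL2 K)) := Nat.card_pos
    have hm1 : m = 1 := by
      rcases Nat.eq_zero_or_pos m with h0 | h0
      · rw [h0] at hm; omega
      · omega
    have heq : Subgroup.zpowers (δ ζ) = Subgroup.closure {δ ζ, w} := by
      apply Subgroup.eq_of_le_of_card_ge hzle
      rw [hm, hm1, Nat.card_zpowers, orderOf_δ hζ, mul_one]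
    have hwz : (w : PGL2 K) ∈ Subgroup.zpowers (δ ζ) := by
      rw [heq]; exact Subgroup.subset_closure (by simp)
    obtain ⟨i, hi⟩ := hwz
    simp only [← map_zpow] at hi
    rw [δ_apply, w, P_eq_iff] at hi
    obtain ⟨u, hu, e1, e2, e3, e4⟩ := hi
    simp at e2

end action
end PGLaux

namespace PGLaux
open OnePoint

variable {K : Type*} [Field K]

section action
variable [DecidableEq K]

theorem orbit_le2 [IsAlgClosed K] [CharZero K] (G : Subgroup (PGL2 K)) [Finite G]
    (x : OnePoint K) (g : PGL2 K) (hg : g ∈ G) (hg1 : g ≠ 1)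
    (hfix : ∀ h ∈ G, g • (h • x) = h • x) :
    Nat.card G ≤ Nat.card (MulAction.stabilizer G x) * 2 := by
  rw [← (MulAction.stabilizer G x).card_mul_index, MulAction.index_stabilizer]
  apply Nat.mul_le_mul_left
  obtain ⟨p, q, hpq, hh⟩ := fix_two g (fin_order hg) hg1
  have : MulAction.orbit G x ⊆ {p, q} := by
    rintro y ⟨h, rfl⟩
    exact (hh _).1 (hfix h h.2)
  calc _ ≤ ({p, q} : Set (OnePoint K)).ncard := Set.ncard_le_ncard this (Set.toFinite _)
    _ ≤ 2 := Set.ncard_pair hpq ▸ le_rfl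

/-- elements of a finite group fixing a common point commute -/
theorem comm_of_fix [CharZero K] (G : Subgroup (PGL2 K)) [Finite G]
    (x : OnePoint K) {g h : PGL2 K} (hg : g ∈ G) (hh : h ∈ G) (hgx : g • x = x) (hhx : h • x = x) :
    g * h = h * g := by
  obtain ⟨c, -, -, -, hc⟩ := stab_gen G x
  obtain ⟨i, rfl⟩ := hc g hg hgx
  obtain ⟨j, rfl⟩ := hc h hh hhx
  exact ((Commute.refl c).zpow_zpow i j).eq

theorem P_comm_δ {ζ : Kˣ} (hζ : ζ ≠ 1) {a b c d : K} {hdet : a * d - b * c ≠ 0} (hd : d ≠ 0)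
    (h : P a b c d hdet * δ ζ = δ ζ * P a b c d hdet) : b = 0 ∧ c = 0 := by
  have hζ1' : (ζ : K) ≠ 1 := by simpa using hζ
  rw [δ_apply, P_mul, P_mul, P_eq_iff] at h
  obtain ⟨u, hu, e1, e2, e3, e4⟩ := h
  simp only [mul_zero, mul_one, add_zero, zero_add, zero_mul, one_mul] at e1 e2 e3 e4
  have hu1 : u = 1 := by
    apply mul_right_cancel₀ hd; rw [one_mul]; exact e4.symm
  rw [hu1] at e2 e3
  constructor
  · by_contra hb
    apply hζ1'
    apply mul_right_cancel₀ hb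
    linear_combination e2
  · by_contra hb
    apply hζ1'
    apply mul_right_cancel₀ hb
    linear_combination -e3

theorem poly1 [IsAlgClosed K] [CharZero K] (G : Subgroup (PGL2 K)) [Finite G] {k : ℕ}
    (hD : Data k G) {ζ : Kˣ} (hζ : IsPrimitiveRoot ζ k) (hmem : δ ζ ∈ G) :
    ∃ (a b c : K) (h : a * (-a) - b * c ≠ 0), a ≠ 0 ∧ b ≠ 0 ∧ c ≠ 0 ∧ P a b c (-a) h ∈ G := by
  have hk3 : 3 ≤ k := by have := hD.1; omega
  have hζ1 : ζ ≠ 1 := by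
    rintro rfl
    have h1 : k = 1 := by simpa using hζ.eq_orderOf
    omega
  have hδ1 : δ ζ ≠ 1 := by
    intro h
    exact hζ1 (δ_inj (by rw [h, map_one]))
  have hstab : ∀ x : OnePoint K, δ ζ • x = x → Nat.card (MulAction.stabilizer G x) = k := by
    intro x hx
    have h1 := hD.2.2.2 x _ hmem hδ1 hx
    have h2 : k ∣ Nat.card (MulAction.stabilizer G x) := by
      have := orderOf_dvd_natCard (⟨⟨δ ζ, hmem⟩, hx⟩ : MulAction.stabilizer G x)
      rw [← Subgroup.orderOf_coe, ← Subgroup.orderOf_coe] at this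
      change orderOf (δ ζ) ∣ _ at this
      rwa [orderOf_δ hζ] at this
    rcases h1 with h1 | h1 | h1
    · rw [h1] at h2
      have := Nat.le_of_dvd (by norm_num) h2
      omega
    · rw [h1] at h2
      have := Nat.le_of_dvd (by norm_num) h2
      omega
    · exact h1
  obtain ⟨y, hy⟩ := hD.2.1
  obtain ⟨t, ht, hty, hto, -⟩ := stab_gen G y
  rw [hy] at hto
  have ht1 : t ≠ 1 := by rintro rfl; simp at hto
  have ht2 : t ^ 2 = 1 := orderOf_dvd_iff_pow_eq_one.1 (by rw [hto])
  have hcard : 12 ≤ Nat.card G ∧ k * 2 < Nat.card G := by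
    have := hD.1
    omega
  have hs1 : ∀ h : PGL2 K, h * t * h⁻¹ ≠ 1 := by
    intro h h0
    rw [mul_inv_eq_one] at h0
    exact ht1 (by simpa using h0)
  have hs2 : ∀ h : PGL2 K, (h * t * h⁻¹) ^ 2 = 1 := by
    intro h
    rw [conj_pow, ht2]; simp
  -- some conjugate does not swap
  have hex : ∃ h ∈ G, (h * t * h⁻¹) • (∞ : OnePoint K) ≠ ((0 : K) : OnePoint K) := by
    by_contra! hcon
    have hcon' : ∀ h ∈ G, (h * t * h⁻¹) • ((0 : K) : OnePoint K) = ∞ := by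
      intro h hh
      have h1 := hcon h hh
      have h2 := hs2 h
      rw [pow_two] at h2
      rw [← h1, ← mul_smul, h2, one_smul]
    have hcentral : ∀ g ∈ G, g * t * g⁻¹ = t := by
      intro g hg
      by_contra hne
      have hu1 : t * (g * t * g⁻¹) ≠ 1 := by
        intro h0
        apply hne
        have : t * t = 1 := by rw [← pow_two]; exact ht2
        exact mul_left_cancel (h0.trans this.symm)
      have := orbit_le2 G ((0 : K) : OnePoint K) (t * (g * t * g⁻¹))
        (mul_mem ht (mul_mem (mul_mem hg ht) (inv_mem hg))) hu1 (by
          intro h hh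
          have e1 := hcon (h⁻¹) (inv_mem hh)
          have e2 := hcon' (h⁻¹ * g) (mul_mem (inv_mem hh) hg)
          have e3 : t * (g * t * g⁻¹) = h * ((h⁻¹ * t * h⁻¹⁻¹) *
            ((h⁻¹ * g) * t * (h⁻¹ * g)⁻¹)) * h⁻¹ := by group
          rw [e3, mul_smul, mul_smul, inv_smul_smul, mul_smul, e2, e1])
      rw [hstab _ ((δ_fix ζ hζ1 _).2 (Or.inl rfl))] at this
      omega
    have := orbit_le2 G y t ht ht1 (by
      intro h hh
      have h1 := hcentral h hh
      rw [mul_inv_eq_iff_eq_mul] at h1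
      rw [← mul_smul, ← h1, mul_smul, hty])
    omega
  obtain ⟨h, hh, hsw⟩ := hex
  have hsG : h * t * h⁻¹ ∈ G := mul_mem (mul_mem hh ht) (inv_mem hh)
  have hfixhy : (h * t * h⁻¹) • (h • y) = h • y := by
    rw [mul_smul, mul_smul, inv_smul_smul, hty]
  have hhy : Nat.card (MulAction.stabilizer G (h • y)) = 2 := by
    exact (Nat.card_congr (MulAction.stabilizerEquivStabilizerOfOrbitRel
      (G := G) (a := h • y) (b := y) ⟨⟨h, hh⟩, rfl⟩).toEquiv).trans hy
  obtain ⟨a, b, c, d, hdet, hP⟩ := P_surj (h * t * h⁻¹)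
  have h1 := hs1 h
  have h2 := hs2 h
  rw [hP] at hsG hfixhy h1 h2 hsw
  have had := ord2 h2 h1
  obtain rfl : d = -a := by linear_combination had
  rw [ne_eq, P_infty_zero] at hsw
  have hbc : ¬ (b = 0 ∧ c = 0) := by
    rintro ⟨rfl, rfl⟩
    have hfix2 : h • y = ((0 : K) : OnePoint K) ∨ h • y = ∞ := by
      have e : P a 0 0 (-a) hdet = δ (-1) := by
        rw [δ_apply, P_eq_iff]
        exact ⟨-a⁻¹, by simpa using hsw, by simp [hsw], by simp, by simp, by simp [hsw]⟩
      rw [e] at hfixhy h1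
      refine (δ_fix (-1) ?_ _).1 hfixhy
      intro h0
      rw [h0, map_one] at h1
      exact h1 rfl
    have := hstab _ ((δ_fix ζ hζ1 _).2 hfix2)
    omega
  refine ⟨a, b, c, hdet, hsw, ?_, ?_, hsG⟩
  · intro hb
    exact hbc (P_comm_δ hζ1 (neg_ne_zero.2 hsw) (comm_of_fix G ((0 : K) : OnePoint K) hsG hmem
      ((P_zero_fix _).2 hb) ((δ_fix ζ hζ1 _).2 (Or.inl rfl))))
  · intro hb
    exact hbc (P_comm_δ hζ1 (neg_ne_zero.2 hsw) (comm_of_fix G ∞ hsG hmem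
      ((P_infty_fix _).2 hb) ((δ_fix ζ hζ1 _).2 (Or.inr rfl))))

/-- the trace condition for `g * δ z` -/
theorem tr_cond [IsAlgClosed K] [CharZero K] (G : Subgroup (PGL2 K)) [Finite G] {k : ℕ}
    (hD : Data k G) {z : Kˣ} (hz : z ≠ 1) (hmem : δ z ∈ G) {a b c : K}
    {h : a * (-a) - b * c ≠ 0} (ha : a ≠ 0) (hb : b ≠ 0) (hP : P a b c (-a) h ∈ G) :
    a ^ 2 * (z - 1) ^ 2 = z * (a * (-a) - b * c) ∨
    (k = 4 ∧ a ^ 2 * (z - 1) ^ 2 = 2 * (z * (a * (-a) - b * c))) ∨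
    (k = 5 ∧ (a ^ 2 * (z - 1) ^ 2) ^ 2 - 3 * (a ^ 2 * (z - 1) ^ 2) * (z * (a * (-a) - b * c)) +
      (z * (a * (-a) - b * c)) ^ 2 = 0) := by
  have hz' : (z : K) - 1 ≠ 0 := by rw [sub_ne_zero]; simpa using hz
  have hm := mul_mem hP hmem
  have hpow := hD.pow hm
  have hne : P a b c (-a) h * δ z ≠ 1 := by
    rw [δ_apply, P_mul, ne_eq, P_eq_one_iff]
    rintro ⟨h1, -⟩
    simp at h1
    exact hb h1
  rw [δ_apply, P_mul] at hpow hne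
  have haz := mul_ne_zero ha hz'
  have case3 := fun hp => ord3 hp hne
  rcases hpow with hp | hp | hp
  · exact absurd (by linear_combination ord2 hp hne) haz
  · left
    linear_combination case3 hp
  · rcases hD.1 with ⟨rfl, -⟩ | ⟨rfl, -⟩ | ⟨rfl, -⟩
    · left
      linear_combination case3 hp
    · right; left
      refine ⟨rfl, ?_⟩
      rcases ord4 hp hne with h1 | h1
      · exact absurd (by linear_combination h1) haz
      · linear_combination h1
    · right; right
      refine ⟨rfl, ?_⟩
      linear_combination ord5 hp hne

theorem golden [CharZero K] {ψ u v : K} (hψ : ψ ^ 2 - 3 * ψ + 1 = 0) (huv : v = u * ψ)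
    (hu : u ^ 2 - 3 * u + 1 = 0) (hv : v ^ 2 - 3 * v + 1 = 0) : False := by
  have h1 : (u - ψ) * (u - (3 - ψ)) = 0 := by linear_combination hu - hψ
  rcases mul_eq_zero.1 h1 with h | h
  · have hu' : u = ψ := by linear_combination h
    subst hu'
    have hv' : v = 3 * u - 1 := by rw [huv]; linear_combination hψ
    rw [hv'] at hv
    have h2 : 3 * u = (1:K) := by linear_combination hv / 2 * 0 + (hv - 9 * hψ) / 2 * 0 + (by
      have : (9 * u ^ 2 - 15 * u + 5 : K) = 0 := by linear_combination hv
      have : (12 * u - 4 : K) = 0 := by linear_combination this - 9 * hψ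
      linear_combination this / 4 : 3 * u = (1:K))
    have h3 : u = 1 / 3 := by linear_combination h2 / 3
    rw [h3] at hψ
    norm_num at hψ
  · have hu' : u = 3 - ψ := by linear_combination h
    have hv' : v = 1 := by rw [huv, hu']; linear_combination -hψ
    rw [hv'] at hv
    norm_num at hv

theorem poly2 [IsAlgClosed K] [CharZero K] (G : Subgroup (PGL2 K)) [Finite G] {k : ℕ}
    (hD : Data k G) {ζ : Kˣ} (hζ : IsPrimitiveRoot ζ k) (hmem : δ ζ ∈ G) :
    ∃ (a b c : K) (h : a * (-a) - b * c ≠ 0), P a b c (-a) h ∈ G ∧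
      a ^ 2 * (ζ - 1) ^ 2 = ζ * (a * (-a) - b * c) := by
  obtain ⟨a, b, c, h, ha, hb, hc, hP⟩ := poly1 G hD hζ hmem
  have hk3 : 3 ≤ k := by have := hD.1; omega
  have hζ1 : ζ ≠ 1 := by
    rintro rfl
    have h1 : k = 1 := by simpa using hζ.eq_orderOf
    omega
  have hζ0 : (ζ : K) ≠ 0 := ζ.ne_zero
  have hζK : IsPrimitiveRoot (ζ : K) k :=
    hζ.map_of_injective (f := Units.coeHom K) Units.val_injective
  rcases tr_cond G hD hζ1 hmem ha hb hP with h1 | ⟨hk, h1⟩ | ⟨hk, h1⟩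
  · exact ⟨a, b, c, h, hP, h1⟩
  · exfalso
    subst hk
    have h4 : (ζ : K) ^ 4 = 1 := hζK.pow_eq_one
    have h2 : (ζ : K) ^ 2 ≠ 1 := hζK.pow_ne_one_of_pos_of_lt (by norm_num) (by norm_num)
    have h5 : (ζ : K) ^ 2 = -1 := by
      have : ((ζ : K) ^ 2 - 1) * ((ζ : K) ^ 2 + 1) = 0 := by linear_combination h4
      rcases mul_eq_zero.1 this with h | h
      · exact absurd (by linear_combination h) h2
      · linear_combination h
    have h6 : (2 * (ζ : K)) * (b * c) = 0 := by linear_combination h1 - a ^ 2 * h5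
    simp [hb, hc] at h6
  · subst hk
    have h5 : (ζ : K) ^ 5 = 1 := hζK.pow_eq_one
    have hn1 : (ζ : K) - 1 ≠ 0 := by rw [sub_ne_zero]; simpa using hζ1
    have hcyc : (ζ : K) ^ 4 + (ζ : K) ^ 3 + (ζ : K) ^ 2 + ζ + 1 = 0 := by
      apply mul_left_cancel₀ hn1
      linear_combination h5
    have hζ2 : ζ ^ 2 ≠ 1 := hζ.pow_ne_one_of_pos_of_lt (by norm_num) (by norm_num)
    have hmem2 : δ (ζ ^ 2) ∈ G := by rw [map_pow]; exact pow_mem hmem 2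
    rcases tr_cond G hD hζ2 hmem2 ha hb hP with h2 | ⟨hk, h2⟩ | ⟨hk, h2⟩
    · -- switch to another involution
      have hj := mul_mem hP hmem2
      have hm := mul_mem (mul_mem hj hP) (inv_mem hj)
      obtain ⟨z, hz⟩ : ∃ z : K, z = ((ζ ^ 2 : Kˣ) : K) := ⟨_, rfl⟩
      have hzζ : z = (ζ : K) ^ 2 := by rw [hz]; push_cast; rfl
      have hz0 : z ≠ 0 := by rw [hz]; exact Units.ne_zero _
      have hz1 : z - 1 ≠ 0 := by
        rw [hz, sub_ne_zero]
        exact fun h0 => hζ2 (Units.ext h0)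
      rw [← hz] at h2
      rw [δ_apply, P_mul, P_inv, P_mul, P_mul] at hm
      obtain ⟨a', ha'⟩ : ∃ a', a' = -a ^ 3 * z - a * b * c - a * b * c * z ^ 2 + a * b * c * z :=
        ⟨_, rfl⟩
      obtain ⟨b', hb'⟩ : ∃ b', b' = -b * (a ^ 2 * z + b * c) + a * z * (a * b * z - a * b) :=
        ⟨_, rfl⟩
      obtain ⟨c', hc'⟩ : ∃ c', c' = -a * (a * c * z - a * c) - c * z * (b * c * z + a ^ 2) :=
        ⟨_, rfl⟩
      have hdet : a' * (-a') - b' * c' = z ^ 2 * (a * (-a) - b * c) ^ 3 := by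
        rw [ha', hb', hc']; ring
      have hdet0 : a' * (-a') - b' * c' ≠ 0 := by
        rw [hdet]; exact mul_ne_zero (pow_ne_zero _ hz0) (pow_ne_zero _ h)
      refine ⟨a', b', c', hdet0, ?_, ?_⟩
      · convert hm using 1
        rw [P_eq_iff]
        rw [← hz]
        refine ⟨1, one_ne_zero, ?_, ?_, ?_, ?_⟩
        · rw [ha']; ring
        · rw [hb']; ring
        · rw [hc']; ring
        · rw [ha']; ring
      · rw [hdet]
        have ha2 : a' = a * (a * (-a) - b * c) * (z ^ 2 + 1) := by
          rw [ha']; linear_combination a * h2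
        rw [ha2]
        apply mul_left_cancel₀ (pow_ne_zero 2 hz1)
        have h8 : (z ^ 2 + 1) ^ 2 = (ζ : K) ^ 3 * (ζ + 1) ^ 2 := by
          rw [hzζ]; linear_combination ((ζ : K) ^ 3 - 1) * h5
        have e1 : (z - 1) ^ 2 * ((a * (a * (-a) - b * c) * (z ^ 2 + 1)) ^ 2 * ((ζ : K) - 1) ^ 2) =
            z * (a * (-a) - b * c) ^ 3 * ((ζ : K) ^ 3 * (ζ + 1) ^ 2) * ((ζ : K) - 1) ^ 2 := by
          rw [← h8]
          linear_combination (a * (-a) - b * c) ^ 2 * (z ^ 2 + 1) ^ 2 * ((ζ : K) - 1) ^ 2 * h2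
        rw [e1, hzζ]
        ring
    · omega
    · exfalso
      obtain ⟨Δ, hΔ⟩ : ∃ Δ, Δ = a * (-a) - b * c := ⟨_, rfl⟩
      rw [← hΔ] at h1 h2
      have hΔ0 : Δ ≠ 0 := hΔ ▸ h
      push_cast at h2
      set z : K := (ζ : K) with hz
      let u := a ^ 2 * (z - 1) ^ 2 / (z * Δ)
      let v := a ^ 2 * (z ^ 2 - 1) ^ 2 / (z ^ 2 * Δ)
      let ψ := (z + 1) ^ 2 / z
      refine golden (ψ := ψ) (u := u) (v := v) ?_ ?_ ?_ ?_
      · simp only [ψ]; field_simp; linear_combination hcyc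
      · simp only [ψ, u, v]; field_simp; ring
      · simp only [u]; field_simp; linear_combination h1
      · simp only [v]; field_simp; linear_combination h2

end action
end PGLaux

namespace PGLaux
open OnePoint

variable {K : Type*} [Field K]

theorem sq2 {G H : Subgroup (PGL2 K)} [Finite G] (hle : H ≤ G)
    (hcard : 2 * Nat.card H = Nat.card G) {g : PGL2 K} (hg : g ∈ G) :
    g ^ 2 ∈ H := by
  have hi : (H.subgroupOf G).index = 2 := by
    have h1 := (H.subgroupOf G).card_mul_index
    have h2 : Nat.card (H.subgroupOf G) = Nat.card H :=
      Nat.card_congr (Subgroup.subgroupOfEquivOfLe hle).toEquiv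
    have h3 : 0 < Nat.card G := Nat.card_pos
    rw [h2, ← hcard, mul_comm 2] at h1
    exact Nat.eq_of_mul_eq_mul_left (by omega) h1
  have := Subgroup.sq_mem_of_index_two hi ⟨g, hg⟩
  simpa [Subgroup.mem_subgroupOf] using this

theorem root_facts [CharZero K] {k : ℕ} (hk : k = 3 ∨ k = 4 ∨ k = 5) {ζ : Kˣ}
    (hζ : IsPrimitiveRoot ζ k) :
    (ζ : K) ≠ 1 ∧ (ζ : K) ^ 2 ≠ 1 ∧ (ζ : K) ^ 2 - ζ + 1 ≠ 0 := by
  have hζK : IsPrimitiveRoot (ζ : K) k :=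
    hζ.map_of_injective (f := Units.coeHom K) Units.val_injective
  refine ⟨?_, ?_, ?_⟩
  · have := hζK.pow_ne_one_of_pos_of_lt (l := 1) (by norm_num) (by omega)
    simpa using this
  · exact hζK.pow_ne_one_of_pos_of_lt (by norm_num) (by omega)
  · intro h
    have h3 : (ζ : K) ^ 3 = -1 := by linear_combination (ζ + 1 : K) * h
    have h6 : (ζ : K) ^ 6 = 1 := by linear_combination ((ζ : K) ^ 3 - 1) * h3
    have h2 := hζK.dvd_of_pow_eq_one 6 h6
    have hk3 : k = 3 := by
      rcases hk with rfl | rfl | rfl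
      · rfl
      · norm_num at h2
      · norm_num at h2
    subst hk3
    have := hζK.pow_eq_one
    rw [h3] at this
    norm_num [neg_eq_iff_add_eq_zero] at this

section action
variable [DecidableEq K]

theorem Data.k_cases {k : ℕ} {G : Subgroup (PGL2 K)} (hD : Data k G) : k = 3 ∨ k = 4 ∨ k = 5 := by
  have := hD.1
  omega

theorem poly3 [IsAlgClosed K] [CharZero K] (G : Subgroup (PGL2 K)) [Finite G] {k : ℕ}
    (hD : Data k G) {ζ : Kˣ} (hζ : IsPrimitiveRoot ζ k) (hmem : δ ζ ∈ G) :
    ∃ (hd : (1 : K) * (-1) - 1 * (1 - ζ - (ζ : K)⁻¹) ≠ 0) (h : PGL2 K),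
      δ ζ ∈ cj h G ∧ P 1 1 (1 - ζ - (ζ : K)⁻¹) (-1) hd ∈ cj h G := by
  obtain ⟨a, b, c, h, hP, hE⟩ := poly2 G hD hζ hmem
  obtain ⟨f1, f2, f3⟩ := root_facts hD.k_cases hζ
  have hζ0 : (ζ : K) ≠ 0 := ζ.ne_zero
  have ha : a ≠ 0 := by
    rintro rfl
    rw [zero_pow two_ne_zero, zero_mul] at hE
    exact mul_ne_zero hζ0 h hE.symm
  have hb : b ≠ 0 := by
    rintro rfl
    apply f3
    apply mul_left_cancel₀ (pow_ne_zero 2 ha)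
    linear_combination hE
  have hd : (1 : K) * (-1) - 1 * (1 - ζ - (ζ : K)⁻¹) ≠ 0 := by
    have : (1 : K) * (-1) - 1 * (1 - ζ - (ζ : K)⁻¹) = (ζ - 1) ^ 2 / ζ := by field_simp; ring
    rw [this]
    exact div_ne_zero (pow_ne_zero _ (sub_ne_zero.2 f1)) hζ0
  let s : Kˣ := Units.mk0 (a / b) (div_ne_zero ha hb)
  refine ⟨hd, δ s, ?_, ?_⟩
  · have := mem_cj (h := δ s) hmem
    rwa [δ_comm] at this
  · have := mem_cj (h := δ s) hP
    rw [δ_conj] at this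
    convert this using 1
    rw [P_eq_iff]
    refine ⟨a, ha, by ring, ?_, ?_, by ring⟩
    · simp only [s, Units.val_mk0]; field_simp
    · simp only [s, Units.val_mk0]; field_simp; linear_combination hE

/-- two elements of a common cyclic group cannot be in general position -/
theorem not_common {κ : K} (hκ : κ ≠ 0) {hd : (1 : K) * (-1) - 1 * κ ≠ 0} {t : Kˣ}
    [IsAlgClosed K] (ht : t ≠ 1) {c : PGL2 K} (h1 : δ t ∈ Subgroup.zpowers c)
    (h2 : P 1 1 κ (-1) hd * δ t * (P 1 1 κ (-1) hd)⁻¹ ∈ Subgroup.zpowers c) : False := by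
  obtain ⟨p, hp⟩ := exists_fix c
  have hz : ∀ g ∈ Subgroup.zpowers c, g • p = p := by
    have : Subgroup.zpowers c ≤ MulAction.stabilizer (PGL2 K) p := by
      rw [Subgroup.zpowers_le]; exact hp
    exact fun g hg => this hg
  have ht' : (t : K) - 1 ≠ 0 := by rw [sub_ne_zero]; simpa using ht
  have e1 := (δ_fix t ht p).1 (hz _ h1)
  have e2 := hz _ h2
  rw [δ_apply, P_mul, P_inv, P_mul] at e2
  rcases e1 with rfl | rfl
  · rw [P_zero_fix] at e2
    exact ht' (by linear_combination -e2)
  · rw [P_infty_fix] at e2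
    exact mul_ne_zero hκ ht' (by linear_combination -e2)

theorem poly4 [IsAlgClosed K] [CharZero K] (G : Subgroup (PGL2 K)) [Finite G]
    (hC : ¬ Cyc G) (hDi : ¬ Dih G) :
    ∃ k : ℕ, ((k = 3 ∧ Nat.card G = 12) ∨ (k = 4 ∧ Nat.card G = 24) ∨
      (k = 5 ∧ Nat.card G = 60)) ∧ ∀ ζ : Kˣ, IsPrimitiveRoot ζ k →
      ∃ (hd : (1 : K) * (-1) - 1 * (1 - ζ - (ζ : K)⁻¹) ≠ 0) (h : PGL2 K),
        cj h G = Subgroup.closure {δ ζ, P 1 1 (1 - ζ - (ζ : K)⁻¹) (-1) hd} := by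
  obtain ⟨k, hD⟩ := ((classify G).resolve_left hC).resolve_left hDi
  refine ⟨k, hD.1, fun ζ hζ => ?_⟩
  obtain ⟨x, hx⟩ := hD.2.2.1
  obtain ⟨c, hc, -, hco, -⟩ := stab_gen G x
  rw [hx] at hco
  obtain ⟨h, hh⟩ := conj_to_δ G hc hco hζ
  have hD' : Data k (cj h G) := by
    obtain ⟨k', hk'⟩ := ((classify (cj h G)).resolve_left fun h0 => hC (Cyc_cj h0)).resolve_left
      fun h0 => hDi (Dih_cj h0)
    have h1 := hk'.1
    have h2 := hD.1
    rw [card_cj] at h1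
    obtain rfl : k' = k := by omega
    exact hk'
  obtain ⟨hd, h', hm1, hm2⟩ := poly3 (cj h G) hD' hζ hh
  rw [cj_cj] at hm1 hm2
  refine ⟨hd, h' * h, ?_⟩
  obtain ⟨f1, f2, f3⟩ := root_facts hD.k_cases hζ
  have hζ0 : (ζ : K) ≠ 0 := ζ.ne_zero
  have hκ : 1 - ζ - (ζ : K)⁻¹ ≠ 0 := by
    intro h0
    apply f3
    have := congrArg (fun y => -(ζ : K) * y) h0
    field_simp at this
    linear_combination this
  generalize 1 - ζ - (ζ : K)⁻¹ = κ at hd hm2 hκ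
  set H := Subgroup.closure {δ ζ, P 1 1 κ (-1) hd} with hH
  have hle : H ≤ cj (h' * h) G := by
    rw [hH, Subgroup.closure_le]
    rintro y (rfl | rfl)
    · exact hm1
    · exact hm2
  have hδH : δ ζ ∈ H := Subgroup.subset_closure (by simp)
  have hgH : P 1 1 κ (-1) hd ∈ H := Subgroup.subset_closure (by simp)
  have hfin : Finite H := Finite.of_injective _ (Subgroup.inclusion_injective hle)
  have hdvd : Nat.card H ∣ Nat.card G := by
    rw [← card_cj (h' * h) G]; exact Subgroup.card_dvd_of_le hle
  have hζ2 : ζ ^ 2 ≠ 1 := by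
    intro h0; apply f2; rw [← Units.val_pow_eq_pow_val, h0, Units.val_one]
  have hδ2 : δ (ζ ^ 2) = (δ ζ) ^ 2 := map_pow _ _ _
  rcases classify H with hc | hc | ⟨k', hk'⟩
  · exfalso
    obtain ⟨c, hc, ho⟩ := hc
    have : Subgroup.zpowers c = H := by
      apply Subgroup.eq_of_le_of_card_ge
      · simpa using hc
      · rw [Nat.card_zpowers, ho]
    have e : δ (ζ ^ 2) ∈ H := by rw [hδ2]; exact pow_mem hδH 2
    refine not_common hκ (hd := hd) hζ2 (c := c) ?_ ?_
    · rw [this]; exact e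
    · rw [this]; exact mul_mem (mul_mem hgH e) (inv_mem hgH)
  · exfalso
    obtain ⟨c, hc, ho⟩ := hc
    have hle2 : Subgroup.zpowers c ≤ H := by simpa using hc
    have hcard2 : 2 * Nat.card (Subgroup.zpowers c) = Nat.card H := by
      rw [Nat.card_zpowers, ho]
    have e : δ (ζ ^ 2) ∈ Subgroup.zpowers c := by rw [hδ2]; exact sq2 hle2 hcard2 hδH
    exact not_common hκ (hd := hd) hζ2 (c := c) e (norm2 hle2 hcard2 hgH e)
  · symm
    apply Subgroup.eq_of_le_of_card_ge hle
    rw [card_cj]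
    have hp := hk'.pow hδH
    simp only [← orderOf_dvd_iff_pow_eq_one, orderOf_δ hζ] at hp
    rcases hD.1 with ⟨rfl, e⟩ | ⟨rfl, e⟩ | ⟨rfl, e⟩ <;> rcases hk'.1 with ⟨rfl, e'⟩ | ⟨rfl, e'⟩ | ⟨rfl, e'⟩ <;>
      rw [e, e'] at hdvd <;> omega

theorem exists_prim [IsAlgClosed K] [CharZero K] (n : ℕ) (hn : 0 < n) :
    ∃ ζ : Kˣ, IsPrimitiveRoot ζ n := by
  have : NeZero n := ⟨hn.ne'⟩
  have : NeZero (n : K) := ⟨by exact_mod_cast hn.ne'⟩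
  obtain ⟨ζ, hζ⟩ := HasEnoughRootsOfUnity.exists_primitiveRoot K n
  obtain ⟨u, rfl⟩ := hζ.isUnit hn.ne'
  exact ⟨u, IsPrimitiveRoot.coe_units_iff.1 hζ⟩

theorem transfer {G₁ G₂ : Subgroup (PGL2 K)} (e : G₁ ≃* G₂) :
    (Cyc G₁ → Cyc G₂) ∧ (Dih G₁ → Dih G₂) := by
  have hcard : Nat.card G₁ = Nat.card G₂ := Nat.card_congr e.toEquiv
  have ho : ∀ (g : PGL2 K) (hg : g ∈ G₁), orderOf (e ⟨g, hg⟩ : PGL2 K) = orderOf g := by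
    intro g hg
    rw [Subgroup.orderOf_coe, MulEquiv.orderOf_eq, ← Subgroup.orderOf_coe]
  constructor
  · rintro ⟨g, hg, h⟩
    exact ⟨e ⟨g, hg⟩, (e ⟨g, hg⟩).2, by rw [ho, h, hcard]⟩
  · rintro ⟨g, hg, h⟩
    exact ⟨e ⟨g, hg⟩, (e ⟨g, hg⟩).2, by rw [ho, h, hcard]⟩

theorem main [IsAlgClosed K] [CharZero K] (G₁ G₂ : Subgroup (PGL2 K)) [Finite G₁] [Finite G₂]
    (e : G₁ ≃* G₂) : ∃ h₁ h₂ : PGL2 K, cj h₁ G₁ = cj h₂ G₂ := by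
  have hcard : Nat.card G₁ = Nat.card G₂ := Nat.card_congr e.toEquiv
  have hpos : 0 < Nat.card G₁ := Nat.card_pos
  by_cases hC : Cyc G₁
  · have hC2 := (transfer e).1 hC
    obtain ⟨ζ, hζ⟩ := exists_prim (K := K) (Nat.card G₁) hpos
    obtain ⟨h₁, e₁⟩ := cyc_nf G₁ hC hζ
    obtain ⟨h₂, e₂⟩ := cyc_nf G₂ hC2 (hcard ▸ hζ)
    exact ⟨h₁, h₂, e₁.trans e₂.symm⟩
  have hC2 : ¬ Cyc G₂ := fun h => hC ((transfer e.symm).1 h)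
  by_cases hD : Dih G₁
  · have hD2 := (transfer e).2 hD
    obtain ⟨g, hg, hn⟩ := hD
    obtain ⟨ζ, hζ⟩ := exists_prim (K := K) (orderOf g) (by omega)
    obtain ⟨h₁, e₁⟩ := dih_nf G₁ ⟨g, hg, hn⟩ hC hn hζ
    obtain ⟨h₂, e₂⟩ := dih_nf G₂ hD2 hC2 (hn.trans hcard) hζ
    exact ⟨h₁, h₂, e₁.trans e₂.symm⟩
  have hD2 : ¬ Dih G₂ := fun h => hD ((transfer e.symm).2 h)
  obtain ⟨k, hk, H1⟩ := poly4 G₁ hC hD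
  obtain ⟨k', hk', H2⟩ := poly4 G₂ hC2 hD2
  obtain rfl : k' = k := by omega
  obtain ⟨ζ, hζ⟩ := exists_prim (K := K) k' (by omega)
  obtain ⟨_, h₁, e₁⟩ := H1 ζ hζ
  obtain ⟨_, h₂, e₂⟩ := H2 ζ hζ
  exact ⟨h₁, h₂, e₁.trans e₂.symm⟩

end action
end PGLaux

/-- Let `K` be an algebraically closed field of characteristic zero.  Any two finite
subgroups of `PGL(2,K)` that are isomorphic as abstract groups are conjugate in
`PGL(2,K)`. -/
theorem finite_subgroups_pgl2_isomorphic_imp_conjugate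
    (K : Type*) [Field K] [IsAlgClosed K] [CharZero K]
    (G₁ G₂ : Subgroup (PGL2 K)) [Finite G₁] [Finite G₂]
    (h : Nonempty (G₁ ≃* G₂)) :
    ∃ g : PGL2 K, Subgroup.map (MulAut.conj g).toMonoidHom G₁ = G₂ := by
  classical
  obtain ⟨e⟩ := h
  obtain ⟨h₁, h₂, hh⟩ := PGLaux.main G₁ G₂ e
  refine ⟨h₂⁻¹ * h₁, ?_⟩
  have := congrArg (PGLaux.cj h₂⁻¹) hh
  rw [PGLaux.cj_cj, PGLaux.cj_cj, inv_mul_cancel] at this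
  change PGLaux.cj _ _ = _
  rw [this]
  ext x
  simp [PGLaux.cj]
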